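/- Let R = (Σ_{t ≥ 3, t odd} f(t)·γ*(t)) / (2 · Σ_{t=2}^∞ f(t)·γ*(t)), where the numerator sum is over odd integers t ≥ 3 and the denominator sum is over all integers t ≥ 2 (both series converge). Then 1/(6·Υ) ≥ R ≥ 1/((21 + 6·2^s)·Υ). -/

import Mathlib

open scoped BigOperators

/-- `gammaStar s t` is the number of `s`-tuples `(a_1, …, a_s)` of integers, each `a_i > 1`,
with `lcm(a_1, …, a_s) = t`. -/
noncomputable def gammaStar (s t : ℕ) : ℕ :=
  Nat.card {a : Fin s → ℕ // (∀ i, 1 < a i) ∧ Finset.univ.lcm a = t}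

/-- `rad t` is the radical of `t`: the product of the distinct primes dividing `t`. -/
def rad (t : ℕ) : ℕ := ∏ p ∈ t.primeFactors, p

/-- `f t = 1 / (t · t₀ · φ(t))` where `t₀` is the radical of `t`. -/
noncomputable def f (t : ℕ) : ℝ := 1 / ((t : ℝ) * (rad t : ℝ) * (t.totient : ℝ))

/-- `Υ s = Σ_{r=1}^∞ r^s / 4^r` (reindexed as a `tsum` over `r : ℕ`). -/
noncomputable def upsilon (s : ℕ) : ℝ := ∑' r : ℕ, ((r : ℝ) + 1) ^ s / 4 ^ (r + 1)

/-- The `s`-tuples of integers satisfying `P` whose least common multiple is `t` (for `t ≠ 0`). -/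
def lcmTuples (P : ℕ → Prop) [DecidablePred P] (s t : ℕ) : Finset (Fin s → ℕ) :=
  (Fintype.piFinset fun _ => t.divisors.filter P).filter fun a => Finset.univ.lcm a = t

lemma mem_lcmTuples {P : ℕ → Prop} [DecidablePred P] {s t : ℕ} (ht : t ≠ 0) {a : Fin s → ℕ} :
    a ∈ lcmTuples P s t ↔ (∀ i, P (a i)) ∧ Finset.univ.lcm a = t := by
  simp only [lcmTuples, Finset.mem_filter, Fintype.mem_piFinset, Nat.mem_divisors]
  constructor
  · rintro ⟨h, h'⟩
    exact ⟨fun i => (h i).2, h'⟩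
  · rintro ⟨h, h'⟩
    exact ⟨fun i => ⟨⟨h' ▸ Finset.dvd_lcm (Finset.mem_univ i), ht⟩, h i⟩, h'⟩

lemma gammaStar_eq_card {s t : ℕ} (ht : t ≠ 0) :
    gammaStar s t = (lcmTuples (1 < ·) s t).card := by
  rw [gammaStar, Nat.subtype_card]
  exact fun a => mem_lcmTuples ht

lemma card_lcmTuples_le {P : ℕ → Prop} [DecidablePred P] (s t : ℕ) :
    (lcmTuples P s t).card ≤ t.divisors.card ^ s := by
  refine (Finset.card_filter_le _ _).trans ?_
  rw [Fintype.card_piFinset_const]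
  exact Nat.pow_le_pow_left (Finset.card_filter_le _ _) _

lemma card_lcmTuples_prime_pow_succ {P : ℕ → Prop} [DecidablePred P] {p : ℕ} (hp : p.Prime)
    (s r : ℕ) :
    (lcmTuples P s (p ^ (r + 1))).card + ((p ^ r).divisors.filter P).card ^ s =
      ((p ^ (r + 1)).divisors.filter P).card ^ s := by
  have h0 : p ^ (r + 1) ≠ 0 := pow_ne_zero _ hp.ne_zero
  have h1 : p ^ r ≠ 0 := pow_ne_zero _ hp.ne_zero
  rw [← Fintype.card_piFinset_const, ← Fintype.card_piFinset_const, lcmTuples,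
    ← Finset.card_filter_add_card_filter_not (fun a : Fin s → ℕ => Finset.univ.lcm a = p ^ (r + 1))
      (s := Fintype.piFinset fun _ => (p ^ (r + 1)).divisors.filter P)]
  congr 2
  ext a
  simp only [Finset.mem_filter, Fintype.mem_piFinset, Nat.mem_divisors]
  constructor
  · intro h
    refine ⟨fun i => ⟨⟨(h i).1.1.trans (pow_dvd_pow _ r.le_succ), h0⟩, (h i).2⟩, fun h' => ?_⟩
    have : p ^ (r + 1) ∣ p ^ r := h' ▸ Finset.lcm_dvd fun i _ => (h i).1.1
    exact absurd ((Nat.pow_dvd_pow_iff_le_right hp.one_lt).1 this) (by omega)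
  · rintro ⟨h, h'⟩ i
    refine ⟨⟨(Finset.dvd_lcm (Finset.mem_univ i)).trans ?_, h1⟩, (h i).2⟩
    have h2 : Finset.univ.lcm a ∣ p ^ (r + 1) := Finset.lcm_dvd fun i _ => (h i).1.1
    obtain ⟨k, hk, hk'⟩ := (Nat.dvd_prime_pow hp).1 h2
    rw [hk'] at h' ⊢
    refine pow_dvd_pow _ (Nat.le_of_lt_succ (lt_of_le_of_ne hk fun e => h' (by rw [e])))

lemma filter_pos_divisors (n : ℕ) : n.divisors.filter (0 < ·) = n.divisors :=
  Finset.filter_true_of_mem fun _ h => Nat.pos_of_mem_divisors h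

lemma card_filter_one_lt_divisors_prime_pow {p : ℕ} (hp : p.Prime) (r : ℕ) :
    ((p ^ r).divisors.filter (1 < ·)).card = r := by
  have : (p ^ r).divisors.filter (1 < ·) = (p ^ r).divisors.erase 1 := by
    ext d
    have : d ∈ (p ^ r).divisors → 0 < d := fun h => Nat.pos_of_mem_divisors h
    simp only [Finset.mem_filter, Finset.mem_erase]
    constructor
    · rintro ⟨h1, h2⟩
      exact ⟨by omega, h1⟩
    · rintro ⟨h1, h2⟩
      have := this h2
      exact ⟨h2, by omega⟩
  rw [this, Finset.card_erase_of_mem (by simp [hp.ne_zero]), Nat.divisors_prime_pow hp]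
  simp

lemma card_lcmTuples_pos_prime_pow {p : ℕ} (hp : p.Prime) {s : ℕ} (hs : 1 ≤ s) (r : ℕ) :
    (lcmTuples (0 < ·) s (p ^ r)).card + r ^ s = (r + 1) ^ s := by
  cases r with
  | zero =>
    have : lcmTuples (0 < ·) s (p ^ 0) = {fun _ => 1} := by
      ext a
      rw [mem_lcmTuples (by simp), Finset.mem_singleton]
      constructor
      · rintro ⟨_, h⟩
        ext i
        exact Nat.dvd_one.1 ((pow_zero p ▸ h) ▸ Finset.dvd_lcm (Finset.mem_univ i))
      · rintro rfl
        exact ⟨fun _ => one_pos, Nat.dvd_one.1 (Finset.lcm_dvd fun i _ => dvd_rfl)⟩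
    rw [this]
    simp [show s ≠ 0 by omega]
  | succ r =>
    have := card_lcmTuples_prime_pow_succ (P := (0 < ·)) hp s r
    rwa [filter_pos_divisors, filter_pos_divisors, Nat.divisors_prime_pow hp,
      Nat.divisors_prime_pow hp, Finset.card_map, Finset.card_map, Finset.card_range,
      Finset.card_range] at this

lemma gammaStar_prime_pow_succ {p : ℕ} (hp : p.Prime) (s r : ℕ) :
    gammaStar s (p ^ (r + 1)) + r ^ s = (r + 1) ^ s := by
  have := card_lcmTuples_prime_pow_succ (P := (1 < ·)) hp s r
  rwa [card_filter_one_lt_divisors_prime_pow hp, card_filter_one_lt_divisors_prime_pow hp,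
    ← gammaStar_eq_card (pow_ne_zero _ hp.ne_zero)] at this

lemma gammaStar_one {s : ℕ} (hs : 1 ≤ s) : gammaStar s 1 = 0 := by
  rw [gammaStar_eq_card one_ne_zero, Finset.card_eq_zero, Finset.eq_empty_iff_forall_notMem]
  intro a ha
  rw [mem_lcmTuples one_ne_zero] at ha
  have h1 := ha.1 ⟨0, hs⟩
  have h2 : a ⟨0, hs⟩ ∣ 1 := ha.2 ▸ Finset.dvd_lcm (Finset.mem_univ _)
  rw [Nat.dvd_one.1 h2] at h1
  exact lt_irrefl _ h1

lemma Nat.Coprime.lcm_mul_eq {s x y : ℕ} (hxy : x.Coprime y) {a b : Fin s → ℕ}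
    (ha : Finset.univ.lcm a = x) (hb : Finset.univ.lcm b = y) :
    Finset.univ.lcm (fun i => a i * b i) = x * y := by
  refine Nat.dvd_antisymm (Finset.lcm_dvd fun i hi => ?_) (hxy.mul_dvd_of_dvd_of_dvd ?_ ?_)
  · exact Nat.mul_dvd_mul (ha ▸ Finset.dvd_lcm hi) (hb ▸ Finset.dvd_lcm hi)
  · rw [← ha]
    exact Finset.lcm_dvd fun i hi =>
      (Nat.dvd_mul_right _ _).trans (Finset.dvd_lcm (f := fun i => a i * b i) hi)
  · rw [← hb]
    exact Finset.lcm_dvd fun i hi =>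
      (Nat.dvd_mul_left _ _).trans (Finset.dvd_lcm (f := fun i => a i * b i) hi)

lemma Nat.Coprime.gcd_mul_eq {x y a b : ℕ} (hxy : x.Coprime y) (ha : a ∣ x) (hb : b ∣ y) :
    (a * b).gcd x = a ∧ (a * b).gcd y = b := by
  constructor
  · rw [Nat.Coprime.gcd_mul_right_cancel _ (hxy.symm.coprime_dvd_left hb), Nat.gcd_eq_left ha]
  · rw [Nat.Coprime.gcd_mul_left_cancel _ (hxy.coprime_dvd_left ha), Nat.gcd_eq_left hb]

lemma Nat.Coprime.mul_tuple_injOn {s x y : ℕ} (hxy : x.Coprime y) :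
    Set.InjOn (fun (q : (Fin s → ℕ) × (Fin s → ℕ)) i => q.1 i * q.2 i)
      {q | Finset.univ.lcm q.1 = x ∧ Finset.univ.lcm q.2 = y} := by
  rintro ⟨a, b⟩ ⟨ha, hb⟩ ⟨a', b'⟩ ⟨ha', hb'⟩ h
  have key := fun i => hxy.gcd_mul_eq (a := a i) (b := b i)
    (ha ▸ Finset.dvd_lcm (Finset.mem_univ i)) (hb ▸ Finset.dvd_lcm (Finset.mem_univ i))
  have key' := fun i => hxy.gcd_mul_eq (a := a' i) (b := b' i)
    (ha' ▸ Finset.dvd_lcm (Finset.mem_univ i)) (hb' ▸ Finset.dvd_lcm (Finset.mem_univ i))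
  have h' : ∀ i, a i * b i = a' i * b' i := fun i => congrFun h i
  ext i
  · exact (key i).1.symm.trans (h' i ▸ (key' i).1)
  · exact (key i).2.symm.trans (h' i ▸ (key' i).2)

lemma card_lcmTuples_mul_gammaStar_le {s x y : ℕ} (hx : x ≠ 0) (hy : y ≠ 0) (hxy : x.Coprime y) :
    (lcmTuples (0 < ·) s x).card * gammaStar s y ≤ gammaStar s (x * y) := by
  rw [gammaStar_eq_card hy, gammaStar_eq_card (mul_ne_zero hx hy), ← Finset.card_product]
  refine Finset.card_le_card_of_injOn
    (fun (q : (Fin s → ℕ) × (Fin s → ℕ)) i => q.1 i * q.2 i) ?_ (hxy.mul_tuple_injOn.mono ?_)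
  · rintro ⟨a, b⟩ h
    rw [Finset.mem_coe, Finset.mem_product, mem_lcmTuples hx, mem_lcmTuples hy] at h
    rw [Finset.mem_coe, mem_lcmTuples (mul_ne_zero hx hy)]
    exact ⟨fun i => one_lt_mul_of_le_of_lt (h.1.1 i) (h.2.1 i), hxy.lcm_mul_eq h.1.2 h.2.2⟩
  · rintro ⟨a, b⟩ h
    rw [Finset.mem_coe, Finset.mem_product, mem_lcmTuples hx, mem_lcmTuples hy] at h
    exact ⟨h.1.2, h.2.2⟩

lemma card_lcmTuples_mul_le {s x y : ℕ} (hx : x ≠ 0) (hy : y ≠ 0) (hxy : x.Coprime y) :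
    (lcmTuples (0 < ·) s (x * y)).card ≤
      (lcmTuples (0 < ·) s x).card * (lcmTuples (0 < ·) s y).card := by
  rw [← Finset.card_product]
  refine Finset.card_le_card_of_surjOn
    (fun (q : (Fin s → ℕ) × (Fin s → ℕ)) i => q.1 i * q.2 i) ?_
  intro a ha
  rw [Finset.mem_coe, mem_lcmTuples (mul_ne_zero hx hy)] at ha
  have hdvd : ∀ i, a i ∣ x * y := fun i => ha.2 ▸ Finset.dvd_lcm (Finset.mem_univ i)
  have hprod : ∀ i, (a i).gcd x * (a i).gcd y = a i := fun i => by
    rw [← hxy.gcd_mul, Nat.gcd_eq_left (hdvd i)]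
  have hlx : Finset.univ.lcm (fun i => (a i).gcd x) ∣ x :=
    Finset.lcm_dvd fun i _ => Nat.gcd_dvd_right _ _
  have hly : Finset.univ.lcm (fun i => (a i).gcd y) ∣ y :=
    Finset.lcm_dvd fun i _ => Nat.gcd_dvd_right _ _
  have hl := ((hxy.coprime_dvd_left hlx).coprime_dvd_right hly).lcm_mul_eq
    (a := fun i => (a i).gcd x) (b := fun i => (a i).gcd y) rfl rfl
  simp only [hprod, ha.2] at hl
  have hx' : Finset.univ.lcm (fun i => (a i).gcd x) = x := by
    refine Nat.dvd_antisymm hlx ?_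
    exact (hxy.coprime_dvd_right hly).dvd_of_dvd_mul_right (hl ▸ Nat.dvd_mul_right x y)
  have hy' : Finset.univ.lcm (fun i => (a i).gcd y) = y := by
    refine Nat.dvd_antisymm hly ?_
    exact (hxy.symm.coprime_dvd_right hlx).dvd_of_dvd_mul_left (hl ▸ Nat.dvd_mul_left y x)
  refine ⟨(fun i => (a i).gcd x, fun i => (a i).gcd y), ?_, funext hprod⟩
  rw [Finset.mem_coe, Finset.mem_product, mem_lcmTuples hx, mem_lcmTuples hy]
  exact ⟨⟨fun i => Nat.gcd_pos_of_pos_right _ (Nat.pos_of_ne_zero hx), hx'⟩,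
    ⟨fun i => Nat.gcd_pos_of_pos_right _ (Nat.pos_of_ne_zero hy), hy'⟩⟩

/-- Replacing the entries equal to `1` by `t` turns a tuple with least common multiple `t > 1` into
one without entries equal to `1`. -/
lemma card_lcmTuples_le_mul_gammaStar {s t : ℕ} (ht : 1 < t) :
    (lcmTuples (0 < ·) s t).card ≤ (2 ^ s - 1) * gammaStar s t := by
  have ht0 : t ≠ 0 := by omega
  have hcard : ((Finset.univ : Finset (Finset (Fin s))).erase Finset.univ).card = 2 ^ s - 1 := by
    rw [Finset.card_erase_of_mem (Finset.mem_univ _)]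
    simp
  rw [gammaStar_eq_card ht0, ← hcard, ← Finset.card_product]
  refine Finset.card_le_card_of_injOn
    (fun a => (Finset.univ.filter fun i => a i = 1, fun i => if a i = 1 then t else a i)) ?_ ?_
  · intro a ha
    rw [Finset.mem_coe, mem_lcmTuples ht0] at ha
    rw [Finset.mem_coe, Finset.mem_product, mem_lcmTuples ht0, Finset.mem_erase]
    refine ⟨⟨fun h => ?_, Finset.mem_univ _⟩, fun i => ?_, Nat.dvd_antisymm ?_ ?_⟩
    · have h1 : ∀ i, a i = 1 := fun i => by
        have := Finset.mem_univ i
        rw [← h] at this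
        exact (Finset.mem_filter.1 this).2
      have : t ∣ 1 := ha.2 ▸ Finset.lcm_dvd fun i _ => (h1 i).dvd
      exact ht.ne' (Nat.dvd_one.1 this)
    · have := ha.1 i
      dsimp only
      split_ifs <;> omega
    · refine Finset.lcm_dvd fun i hi => ?_
      dsimp only
      split_ifs
      · exact dvd_rfl
      · exact ha.2 ▸ Finset.dvd_lcm hi
    · conv_lhs => rw [← ha.2]
      refine Finset.lcm_dvd fun i hi => ?_
      by_cases h : a i = 1
      · simp [h]
      · have := Finset.dvd_lcm (f := fun i => if a i = 1 then t else a i) hi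
        simpa only [h, if_false] using this
  · intro a _ b _ h
    rw [Prod.mk.injEq] at h
    ext i
    have h1 : a i = 1 ↔ b i = 1 := by
      have := Finset.ext_iff.1 h.1 i
      simpa using this
    have h2 := congrFun h.2 i
    by_cases hb : b i = 1
    · rw [h1.2 hb, hb]
    · have ha := mt h1.1 hb
      simpa only [ha, hb, if_false] using h2

lemma gammaStar_le_card_lcmTuples {s t : ℕ} (ht : t ≠ 0) :
    gammaStar s t ≤ (lcmTuples (0 < ·) s t).card := by
  rw [gammaStar_eq_card ht]
  refine Finset.card_le_card fun a ha => ?_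
  rw [mem_lcmTuples ht] at ha ⊢
  exact ⟨fun i => zero_lt_one.trans (ha.1 i), ha.2⟩

lemma gammaStar_pos {s t : ℕ} (hs : 1 ≤ s) (ht : 1 < t) : 0 < gammaStar s t := by
  have ht0 : t ≠ 0 := by omega
  rw [gammaStar_eq_card ht0, Finset.card_pos]
  refine ⟨fun _ => t, (mem_lcmTuples ht0).2 ⟨fun _ => ht, Nat.dvd_antisymm ?_ ?_⟩⟩
  · exact Finset.lcm_dvd fun _ _ => dvd_rfl
  · exact Finset.dvd_lcm (f := fun _ : Fin s => t) (Finset.mem_univ ⟨0, hs⟩)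

lemma f_nonneg (t : ℕ) : 0 ≤ f t := by
  unfold f
  positivity

lemma f_mul {x y : ℕ} (hxy : x.Coprime y) : f (x * y) = f x * f y := by
  have hr : rad (x * y) = rad x * rad y := by
    rw [rad, hxy.primeFactors_mul, Finset.prod_union hxy.disjoint_primeFactors, rad, rad]
  rw [f, f, f, hr, Nat.totient_mul hxy]
  push_cast
  rw [div_mul_div_comm]
  congr 1 <;> ring

lemma f_two_pow (r : ℕ) : f (2 ^ r) = 1 / 4 ^ r := by
  cases r with
  | zero => simp [f, rad]
  | succ r =>
    have hr : rad (2 ^ (r + 1)) = 2 := by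
      rw [rad, Nat.primeFactors_prime_pow r.succ_ne_zero Nat.prime_two, Finset.prod_singleton]
    rw [f, hr, Nat.totient_prime_pow_succ Nat.prime_two]
    push_cast
    congr 1
    rw [show (4 : ℝ) = 2 ^ 2 by norm_num, ← pow_mul]
    ring

lemma f_three : f 3 = 1 / 18 := by
  rw [f, rad, Nat.Prime.primeFactors Nat.prime_three, Nat.totient_prime Nat.prime_three]
  norm_num

lemma f_le (t : ℕ) : f t ≤ 1 / (t : ℝ) ^ 2 := by
  rcases Nat.eq_zero_or_pos t with rfl | ht
  · simp [f]
  have h : t ≤ rad t * t.totient := by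
    have h1 := Nat.totient_mul_prod_primeFactors t
    have h2 : 1 ≤ ∏ p ∈ t.primeFactors, (p - 1) := Finset.one_le_prod' fun p hp => by
      have := (Nat.prime_of_mem_primeFactors hp).two_le
      omega
    calc t = t * 1 := (mul_one t).symm
      _ ≤ t * ∏ p ∈ t.primeFactors, (p - 1) := Nat.mul_le_mul_left _ h2
      _ = rad t * t.totient := by rw [← h1, rad, mul_comm]
  have h' : (t : ℝ) ≤ rad t * t.totient := by exact_mod_cast h
  have ht' : (0 : ℝ) < t := by exact_mod_cast ht
  unfold f
  refine one_div_le_one_div_of_le (by positivity) ?_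
  rw [mul_assoc, sq]
  gcongr

open scoped Pointwise in
lemma card_divisors_mul_le (m n : ℕ) :
    (m * n).divisors.card ≤ m.divisors.card * n.divisors.card := by
  rw [Nat.divisors_mul]
  exact Finset.card_mul_le

lemma summable_card_divisors_pow_div_sq (s : ℕ) :
    Summable fun n : ℕ+ => ((n : ℕ).divisors.card : ℝ) ^ s / (n : ℝ) ^ 2 := by
  induction s with
  | zero =>
    have := (Real.summable_one_div_nat_pow (p := 2)).2 one_lt_two
    refine (this.comp_injective PNat.coe_injective).congr fun n => ?_
    simp
  | succ s ih =>
    have hprod := ih.mul_of_nonneg ih (fun _ => by positivity) (fun _ => by positivity)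
    have hsig := (sigmaAntidiagonalEquivProd.summable_iff.2 hprod).sigma
    refine Summable.of_nonneg_of_le (fun _ => by positivity) (fun n => ?_) hsig
    rw [tsum_fintype]
    have hcard : (Finset.univ : Finset (n : ℕ).divisorsAntidiagonal).card
        = (n : ℕ).divisors.card := by
      rw [Finset.card_univ, Fintype.card_coe, ← Nat.map_div_right_divisors, Finset.card_map]
    have hle : ∀ c ∈ (Finset.univ : Finset (n : ℕ).divisorsAntidiagonal),
        ((n : ℕ).divisors.card : ℝ) ^ s / (n : ℝ) ^ 2 ≤
        ((fun x : ℕ+ × ℕ+ => ((x.1 : ℕ).divisors.card : ℝ) ^ s / (x.1 : ℝ) ^ 2 *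
          (((x.2 : ℕ).divisors.card : ℝ) ^ s / (x.2 : ℝ) ^ 2)) ∘ sigmaAntidiagonalEquivProd)
          ⟨n, c⟩ := by
      rintro ⟨⟨a, b⟩, hc⟩ -
      have hab : a * b = n := (Nat.mem_divisorsAntidiagonal.1 hc).1
      simp only [Function.comp, sigmaAntidiagonalEquivProd, divisorsAntidiagonalFactors,
        Equiv.coe_fn_mk, PNat.mk_coe]
      rw [← hab, div_mul_div_comm, ← mul_pow, ← mul_pow]
      push_cast
      gcongr
      exact_mod_cast card_divisors_mul_le a b
    have := Finset.card_nsmul_le_sum _ _ _ hle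
    rw [hcard, nsmul_eq_mul] at this
    refine le_trans (le_of_eq ?_) this
    ring

lemma summable_f_mul_gammaStar (s : ℕ) : Summable fun t : ℕ => f t * (gammaStar s t : ℝ) := by
  have h := (summable_card_divisors_pow_div_sq s)
  have h' : Summable fun n : ℕ => (n.divisors.card : ℝ) ^ s / (n : ℝ) ^ 2 := by
    refine (Function.Injective.summable_iff PNat.coe_injective fun x hx => ?_).1 h
    have : x = 0 := by
      by_contra h0
      exact hx ⟨⟨x, Nat.pos_of_ne_zero h0⟩, rfl⟩
    simp [this]
  refine Summable.of_nonneg_of_le (fun t => mul_nonneg (f_nonneg t) (Nat.cast_nonneg _))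
    (fun t => ?_) h'
  rcases eq_or_ne t 0 with rfl | ht
  · simp [f]
  rw [div_eq_mul_one_div, mul_comm]
  have h1 : (gammaStar s t : ℝ) ≤ (t.divisors.card : ℝ) ^ s := by
    rw [gammaStar_eq_card ht]
    exact_mod_cast card_lcmTuples_le s t
  have := f_nonneg t
  have := f_le t
  gcongr

lemma hasSum_upsilon (s : ℕ) :
    HasSum (fun r : ℕ => ((r : ℝ) + 1) ^ s / 4 ^ (r + 1)) (upsilon s) := by
  have h : Summable fun r : ℕ => (r : ℝ) ^ s * (1 / 4 : ℝ) ^ r :=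
    summable_pow_mul_geometric_of_norm_lt_one s (by norm_num)
  have h' := (summable_nat_add_iff 1).2 h
  refine Summable.hasSum (h'.congr fun r => ?_)
  push_cast
  rw [one_div, inv_pow, div_eq_mul_inv]

lemma upsilon_pos (s : ℕ) : 0 < upsilon s :=
  (hasSum_upsilon s).summable.tsum_pos (fun _ => by positivity) 0 (by positivity)

/-- The numbers of `s`-tuples with least common multiple `2 ^ r`, weighted by `4 ^ (-r)`, sum
to `3 Υ`. -/
lemma hasSum_card_lcmTuples_two_pow {s : ℕ} (hs : 1 ≤ s) :
    HasSum (fun r : ℕ => ((lcmTuples (0 < ·) s (2 ^ r)).card : ℝ) / 4 ^ r) (3 * upsilon s) := by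
  have h1 := (hasSum_upsilon s).mul_left 4
  have h2 : HasSum (fun r : ℕ => (r : ℝ) ^ s / 4 ^ r) (upsilon s) := by
    rw [← hasSum_nat_add_iff' 1]
    simpa [show s ≠ 0 by omega] using hasSum_upsilon s
  have h3 := h1.sub h2
  rw [show 4 * upsilon s - upsilon s = 3 * upsilon s by ring] at h3
  refine Eq.subst (motive := fun u => HasSum u (3 * upsilon s)) (funext fun r => ?_) h3
  have h4 : ((lcmTuples (0 < ·) s (2 ^ r)).card : ℝ) + (r : ℝ) ^ s = ((r : ℝ) + 1) ^ s := by
    exact_mod_cast card_lcmTuples_pos_prime_pow Nat.prime_two hs r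
  rw [← h4, pow_succ]
  field_simp
  ring

lemma hasSum_gammaStar_two_pow {s : ℕ} (hs : 1 ≤ s) :
    HasSum (fun r : ℕ => f (2 ^ r) * (gammaStar s (2 ^ r) : ℝ)) (3 / 4 * upsilon s) := by
  rw [← hasSum_nat_add_iff' 1]
  have h := (hasSum_card_lcmTuples_two_pow hs).div_const 4
  simp only [Finset.range_one, Finset.sum_singleton, pow_zero, gammaStar_one hs, Nat.cast_zero,
    mul_zero, sub_zero]
  rw [show 3 / 4 * upsilon s = 3 * upsilon s / 4 by ring]
  refine Eq.subst (motive := fun u => HasSum u (3 * upsilon s / 4)) (funext fun r => ?_) h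
  have h1 := card_lcmTuples_pos_prime_pow Nat.prime_two hs r
  have h2 := gammaStar_prime_pow_succ Nat.prime_two s r
  rw [show gammaStar s (2 ^ (r + 1)) = (lcmTuples (0 < ·) s (2 ^ r)).card by omega, f_two_pow,
    pow_succ]
  field_simp

lemma coprime_two_pow_odd (r k : ℕ) : (2 ^ r).Coprime (2 * k + 1) :=
  Nat.Coprime.pow_left _ (Nat.coprime_two_left.2 ⟨k, rfl⟩)

lemma two_pow_mul_odd_injective :
    Function.Injective fun q : ℕ × ℕ => 2 ^ q.2 * (2 * q.1 + 1) := by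
  have key : ∀ r r' k k' : ℕ, 2 ^ r * (2 * k + 1) = 2 ^ r' * (2 * k' + 1) → r ≤ r' := by
    intro r r' k k' h
    have h1 : 2 ^ r ∣ 2 ^ r' * (2 * k' + 1) := h ▸ Nat.dvd_mul_right _ _
    exact (Nat.pow_dvd_pow_iff_le_right one_lt_two).1
      ((coprime_two_pow_odd r k').dvd_of_dvd_mul_right h1)
  rintro ⟨k, r⟩ ⟨k', r'⟩ h
  obtain rfl : r = r' := le_antisymm (key _ _ _ _ h) (key _ _ _ _ h.symm)
  have h3 : 2 * k + 1 = 2 * k' + 1 := Nat.eq_of_mul_eq_mul_left (by positivity) h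
  obtain rfl : k = k' := by omega
  rfl

/-- Sorting the natural numbers by their odd part. -/
lemma hasSum_tsum_two_pow_mul_odd {g : ℕ → ℝ} (hg : Summable g) (h0 : g 0 = 0) :
    HasSum (fun k => ∑' r, g (2 ^ r * (2 * k + 1))) (∑' t, g t) := by
  have hs := hg.comp_injective two_pow_mul_odd_injective
  have hsupp : Function.support g ⊆ Set.range fun q : ℕ × ℕ => 2 ^ q.2 * (2 * q.1 + 1) := by
    intro t ht
    have ht0 : t ≠ 0 := by
      rintro rfl
      exact ht h0
    obtain ⟨r, m, ⟨k, rfl⟩, rfl⟩ := Nat.exists_eq_two_pow_mul_odd ht0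
    exact ⟨(k, r), rfl⟩
  rw [← two_pow_mul_odd_injective.tsum_eq hsupp]
  have h := hs.hasSum.prod_fiberwise fun k => (hs.prod_factor k).hasSum
  exact h

lemma tsum_odd_ite {g : ℕ → ℝ} (h1 : g 1 = 0) :
    (∑' t, if 3 ≤ t ∧ Odd t then g t else 0) = ∑' k, g (2 * k + 1) := by
  have hinj : Function.Injective fun k : ℕ => 2 * k + 1 := fun a b h => by
    simp only at h
    omega
  rw [← hinj.tsum_eq]
  · refine tsum_congr fun k => ?_
    rcases Nat.eq_zero_or_pos k with rfl | hk
    · simp [h1]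
    · rw [if_pos ⟨by omega, ⟨k, rfl⟩⟩]
  · intro t ht
    rw [Function.mem_support] at ht
    by_contra hn
    refine ht (if_neg fun h => hn ?_)
    obtain ⟨k, hk⟩ := h.2
    exact ⟨k, hk.symm⟩

lemma card_div_mul_le_f_mul_gammaStar (s r k : ℕ) :
    ((lcmTuples (0 < ·) s (2 ^ r)).card : ℝ) / 4 ^ r *
        (f (2 * k + 1) * (gammaStar s (2 * k + 1) : ℝ)) ≤
      f (2 ^ r * (2 * k + 1)) * (gammaStar s (2 ^ r * (2 * k + 1)) : ℝ) := by
  have h : ((lcmTuples (0 < ·) s (2 ^ r)).card : ℝ) * (gammaStar s (2 * k + 1) : ℝ) ≤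
      (gammaStar s (2 ^ r * (2 * k + 1)) : ℝ) := by
    exact_mod_cast card_lcmTuples_mul_gammaStar_le (by positivity) (by omega)
      (coprime_two_pow_odd r k)
  rw [f_mul (coprime_two_pow_odd r k), f_two_pow]
  have hf := f_nonneg (2 * k + 1)
  calc _ = 1 / 4 ^ r * f (2 * k + 1) * (((lcmTuples (0 < ·) s (2 ^ r)).card : ℝ) *
        (gammaStar s (2 * k + 1) : ℝ)) := by ring
    _ ≤ _ := by gcongr

lemma f_mul_gammaStar_le_card_div_mul (s r : ℕ) {k : ℕ} (hk : 1 ≤ k) :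
    f (2 ^ r * (2 * k + 1)) * (gammaStar s (2 ^ r * (2 * k + 1)) : ℝ) ≤
      ((lcmTuples (0 < ·) s (2 ^ r)).card : ℝ) / 4 ^ r *
        ((2 ^ s - 1) * (f (2 * k + 1) * (gammaStar s (2 * k + 1) : ℝ))) := by
  have h : gammaStar s (2 ^ r * (2 * k + 1)) ≤
      (lcmTuples (0 < ·) s (2 ^ r)).card * ((2 ^ s - 1) * gammaStar s (2 * k + 1)) :=
    (gammaStar_le_card_lcmTuples (by positivity)).trans <|
      (card_lcmTuples_mul_le (by positivity) (by omega) (coprime_two_pow_odd r k)).trans <|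
        Nat.mul_le_mul_left _ (card_lcmTuples_le_mul_gammaStar (by omega))
  have h' : (gammaStar s (2 ^ r * (2 * k + 1)) : ℝ) ≤
      ((lcmTuples (0 < ·) s (2 ^ r)).card : ℝ) *
        ((2 ^ s - 1) * (gammaStar s (2 * k + 1) : ℝ)) := by
    have h1 : ((2 ^ s - 1 : ℕ) : ℝ) = 2 ^ s - 1 := by
      rw [Nat.cast_sub Nat.one_le_two_pow]
      simp
    rw [← h1]
    exact_mod_cast h
  rw [f_mul (coprime_two_pow_odd r k), f_two_pow]
  have hf := f_nonneg (2 * k + 1)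
  calc _ ≤ 1 / 4 ^ r * f (2 * k + 1) * (((lcmTuples (0 < ·) s (2 ^ r)).card : ℝ) *
        ((2 ^ s - 1) * (gammaStar s (2 * k + 1) : ℝ))) := by gcongr
    _ = _ := by ring

/-- Let `R = (Σ_{t ≥ 3, t odd} f(t)·γ*(t)) / (2·Σ_{t=2}^∞ f(t)·γ*(t))`.  Then
`1/(6·Υ) ≥ R ≥ 1/((21 + 6·2^s)·Υ)`. -/
theorem ratio_bounds (s : ℕ) (hs : 1 ≤ s)
    (R : ℝ)
    (hR : R = (∑' t : ℕ, if 3 ≤ t ∧ Odd t then f t * (gammaStar s t : ℝ) else 0) /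
        (2 * ∑' t : ℕ, if 2 ≤ t then f t * (gammaStar s t : ℝ) else 0)) :
    1 / (6 * upsilon s) ≥ R ∧ R ≥ 1 / ((21 + 6 * 2 ^ s) * upsilon s) := by
  set g : ℕ → ℝ := fun t => f t * (gammaStar s t : ℝ) with hg
  have hsum : Summable g := summable_f_mul_gammaStar s
  have hg_nonneg : ∀ t, 0 ≤ g t := fun t => mul_nonneg (f_nonneg t) (Nat.cast_nonneg _)
  have h0 : g 0 = 0 := by simp [hg, f]
  have h1 : g 1 = 0 := by simp [hg, gammaStar_one hs]
  have hden : (∑' t : ℕ, if 2 ≤ t then g t else 0) = ∑' t, g t := by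
    refine tsum_congr fun t => ?_
    split_ifs with ht
    · rfl
    · interval_cases t
      · exact h0.symm
      · exact h1.symm
  have hR' : R = (∑' k, g (2 * k + 1)) / (2 * ∑' t, g t) := by
    rw [hR, ← hden, ← tsum_odd_ite h1]
  set N : ℝ := ∑' k, g (2 * k + 1) with hN
  set D : ℝ := ∑' t, g t with hD
  have hsN : HasSum (fun k => g (2 * k + 1)) N :=
    (hsum.comp_injective (i := fun k : ℕ => 2 * k + 1) fun a b h => by
      simp only at h
      omega).hasSum
  have hsD : HasSum (fun k => ∑' r, g (2 ^ r * (2 * k + 1))) D :=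
    hasSum_tsum_two_pow_mul_odd hsum h0
  have hrow : ∀ k, Summable fun r => g (2 ^ r * (2 * k + 1)) := fun k =>
    (hsum.comp_injective two_pow_mul_odd_injective).prod_factor k
  have hcard := hasSum_card_lcmTuples_two_pow hs
  have hU := upsilon_pos s
  have hN18 : 1 / 18 ≤ N := by
    have h3 : g 3 ≤ N := le_hasSum hsN 1 fun k _ => hg_nonneg _
    have h4 : (1 : ℝ) ≤ gammaStar s 3 := by
      exact_mod_cast gammaStar_pos hs (by norm_num)
    have h5 : g 3 = 1 / 18 * gammaStar s 3 := by rw [hg, ← f_three]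
    linarith
  have hlower : 3 * upsilon s * N ≤ D := by
    refine hasSum_le (fun k => ?_) (hsN.mul_left (3 * upsilon s)) hsD
    exact hasSum_le (fun r => card_div_mul_le_f_mul_gammaStar s r k)
      (hcard.mul_right _) (hrow k).hasSum
  have hupper : D ≤ 3 / 4 * upsilon s + 3 * upsilon s * ((2 ^ s - 1) * N) := by
    have hD1 := (hasSum_nat_add_iff' 1).2 hsD
    have hN1 := (hasSum_nat_add_iff' 1).2 hsN
    have hrow0 : ∑' r, g (2 ^ r) = 3 / 4 * upsilon s := (hasSum_gammaStar_two_pow hs).tsum_eq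
    simp only [Finset.range_one, Finset.sum_singleton, mul_zero, zero_add, mul_one, h1, hrow0,
      sub_zero] at hD1 hN1
    have := hasSum_le (fun k => ?_) hD1 ((hN1.mul_left (2 ^ s - 1)).mul_left (3 * upsilon s))
    · linarith
    · exact hasSum_le (fun r => f_mul_gammaStar_le_card_div_mul s r (Nat.le_add_left 1 k))
        (hrow (k + 1)).hasSum (hcard.mul_right _)
  have hN0 : 0 < N := by linarith
  have hD0 : 0 < D := lt_of_lt_of_le (by positivity) hlower
  rw [hR', ge_iff_le, ge_iff_le, div_le_div_iff₀ (by positivity) (by positivity),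
    div_le_div_iff₀ (by positivity) (by positivity)]
  constructor
  · linarith
  · have h18 : upsilon s * (1 / 18) ≤ upsilon s * N := by gcongr
    linarith
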